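/- Let E₁, E₂, E_k be alphabets with E₁ ∩ E₂ ⊆ E_k ⊆ E := E₁ ∪ E₂, and let f_{1+k}, f_{2+k} be the renaming isomorphisms and P̃ the natural projection erasing the fresh (tilde) letters. A language L ⊆ E* is conditionally decomposable with respect to E₁, E₂ and E_k if and only if f_{1+k}(L) ∥ f_{2+k}(L) ⊆ P̃⁻¹(L). -/

import Mathlib

/- Language-theoretic model of discrete-event systems:
   strings over a finite alphabet (a `Finset` of symbols) are lists,
   natural projections erase letters outside the target alphabet,
   and the parallel composition is the standard synchronous composition. -/

namespace DES

variable {A : Type} [DecidableEq A]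

/-- `star E` is `E*`: the set of finite strings over the alphabet `E`. -/
def star (E : Finset A) : Set (List A) :=
  {w | ∀ a ∈ w, a ∈ E}

/-- The natural projection onto `E₀`: it keeps letters of `E₀` and erases all
other letters. -/
def proj (E₀ : Finset A) (w : List A) : List A :=
  w.filter (· ∈ E₀)

/-- The inverse image `P⁻¹(L) = { s ∈ E* : P(s) ∈ L }` of the natural projection
from `E*` onto `E₀*`. -/
def invProj (E E₀ : Finset A) (L : Set (List A)) : Set (List A) :=
  {s | s ∈ star E ∧ proj E₀ s ∈ L}

/-- Parallel composition `L₁ ∥ L₂ = P₁⁻¹(L₁) ∩ P₂⁻¹(L₂) ⊆ (E₁ ∪ E₂)*` of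
`L₁ ⊆ E₁*` and `L₂ ⊆ E₂*`. -/
def par (E₁ E₂ : Finset A) (L₁ L₂ : Set (List A)) : Set (List A) :=
  invProj (E₁ ∪ E₂) E₁ L₁ ∩ invProj (E₁ ∪ E₂) E₂ L₂

/-- Parallel composition of a finite family `L i ⊆ (E i)*`. -/
def parFam {ι : Type} [Fintype ι] (E : ι → Finset A) (L : ι → Set (List A)) :
    Set (List A) :=
  {w | w ∈ star (Finset.univ.sup E) ∧ ∀ i, proj (E i) w ∈ L i}

/-- The prefix closure of a language. -/
def pref (L : Set (List A)) : Set (List A) :=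
  {w | ∃ u, w ++ u ∈ L}

/-- `K` is conditionally decomposable w.r.t. the alphabets `E i` and `Ek`:
`K = P_{1+k}(K) ∥ ⋯ ∥ P_{n+k}(K)`. -/
def condDecomp {ι : Type} [Fintype ι] (E : ι → Finset A) (Ek : Finset A)
    (K : Set (List A)) : Prop :=
  K = parFam (fun i => E i ∪ Ek) (fun i => proj (E i ∪ Ek) '' K)

/-- Conditional decomposability for two components:
`K = P_{1+k}(K) ∥ P_{2+k}(K)`. -/
def condDecomp2 (E₁ E₂ Ek : Finset A) (K : Set (List A)) : Prop :=
  K = par (E₁ ∪ Ek) (E₂ ∪ Ek) (proj (E₁ ∪ Ek) '' K) (proj (E₂ ∪ Ek) '' K)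

/-- The natural projection from `E'*` onto `E₀*` is an `L`-observer. -/
def observer (E' E₀ : Finset A) (L : Set (List A)) : Prop :=
  ∀ t ∈ proj E₀ '' L, ∀ s ∈ pref L, proj E₀ s <+: t →
    ∃ u ∈ star E', s ++ u ∈ L ∧ proj E₀ (s ++ u) = t

/-- Letter-to-letter renaming map: letters in `Ekeep` are kept, all other
letters are renamed by `g`. -/
def ren (Ekeep : Finset A) (g : A → A) (w : List A) : List A :=
  w.map (fun a => if a ∈ Ekeep then a else g a)


theorem proj_proj_of_subset {E F : Finset A} (h : E ⊆ F) (w : List A) :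
    proj E (proj F w) = proj E w := by
  unfold proj
  rw [List.filter_filter]
  refine List.filter_congr fun a _ => ?_
  by_cases ha : a ∈ E
  · simp [ha, h ha]
  · simp [ha]

theorem proj_mem_star (E : Finset A) (w : List A) : proj E w ∈ star E := by
  intro a ha
  simpa using (List.mem_filter.1 ha).2

theorem proj_eq_self {E : Finset A} {w : List A} (h : w ∈ star E) : proj E w = w :=
  List.filter_eq_self.2 fun a ha => by simpa using h a ha

theorem proj_append (E : Finset A) (v w : List A) :
    proj E (v ++ w) = proj E v ++ proj E w :=
  List.filter_append ..

theorem proj_cons_of_mem {E : Finset A} {a : A} (h : a ∈ E) (w : List A) :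
    proj E (a :: w) = a :: proj E w :=
  List.filter_cons_of_pos (by simpa using h)

theorem proj_cons_of_notMem {E : Finset A} {a : A} (h : a ∉ E) (w : List A) :
    proj E (a :: w) = proj E w :=
  List.filter_cons_of_neg (by simpa using h)

/-- Words that agree on their common letters have a common interleaving. -/
theorem exists_interleaving {E F : Finset A} {v w : List A} (hv : v ∈ star E)
    (hw : w ∈ star F) (h : proj (E ∩ F) v = proj (E ∩ F) w) :
    ∃ s ∈ star (E ∪ F), proj E s = v ∧ proj F s = w := by
  have proj_eq_nil : ∀ u ∈ star F, proj (E ∩ F) u = [] → proj E u = [] := by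
    intro u hu h0
    refine List.filter_eq_nil_iff.2 fun a ha haE => ?_
    have := List.filter_eq_nil_iff.1 h0 a ha
    simp_all [hu a ha]
  induction v generalizing w with
  | nil =>
    exact ⟨w, fun a ha => Finset.mem_union_right _ (hw a ha),
      proj_eq_nil w hw h.symm, proj_eq_self hw⟩
  | cons x v ih =>
    have hx : x ∈ E := hv x (by simp)
    have hv' : v ∈ star E := fun a ha => hv a (by simp [ha])
    by_cases hxF : x ∈ F
    · rw [proj_cons_of_mem (Finset.mem_inter.2 ⟨hx, hxF⟩)] at h
      obtain ⟨w₁, w₂, rfl, hw₁, -, hw₂⟩ := List.filter_eq_cons_iff.1 h.symm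
      have hw₁F : w₁ ∈ star F := fun a ha => hw a (by simp [ha])
      have hw₂F : w₂ ∈ star F := fun a ha => hw a (by simp [ha])
      obtain ⟨s, hs, hsE, hsF⟩ := ih hv' hw₂F hw₂.symm
      refine ⟨w₁ ++ x :: s, ?_, ?_, ?_⟩
      · intro a ha
        rcases List.mem_append.1 ha with ha | ha
        · exact Finset.mem_union_right _ (hw₁F a ha)
        · rcases List.mem_cons.1 ha with rfl | ha
          · exact Finset.mem_union_left _ hx
          · exact hs a ha
      · rw [proj_append, proj_cons_of_mem hx, hsE,
          proj_eq_nil w₁ hw₁F (List.filter_eq_nil_iff.2 hw₁), List.nil_append]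
      · rw [proj_append, proj_cons_of_mem hxF, hsF, proj_eq_self hw₁F]
    · rw [proj_cons_of_notMem (by simp [hxF])] at h
      obtain ⟨s, hs, hsE, hsF⟩ := ih hv' hw h
      refine ⟨x :: s, ?_, ?_, ?_⟩
      · intro a ha
        rcases List.mem_cons.1 ha with rfl | ha
        · exact Finset.mem_union_left _ hx
        · exact hs a ha
      · rw [proj_cons_of_mem hx, hsE]
      · rw [proj_cons_of_notMem hxF, hsF]

/-- Erasing the renamed letters undoes the renaming up to projection. -/
theorem proj_ren {X : Finset A} {g : A → A} {w : List A}
    (h : ∀ a ∈ w, a ∉ X → g a ∉ X) : proj X (ren X g w) = proj X w := by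
  induction w with
  | nil => rfl
  | cons a w ih =>
    have ih := ih fun b hb => h b (by simp [hb])
    have hcons : ren X g (a :: w) = (if a ∈ X then a else g a) :: ren X g w := rfl
    rw [hcons]
    by_cases ha : a ∈ X
    · rw [if_pos ha, proj_cons_of_mem ha, proj_cons_of_mem ha, ih]
    · rw [if_neg ha, proj_cons_of_notMem ha, proj_cons_of_notMem (h a (by simp) ha), ih]

theorem ren_mem_star {X T : Finset A} {g : A → A} {w : List A}
    (h : ∀ a ∈ w, a ∉ X → g a ∈ T) : ren X g w ∈ star (X ∪ T) := by
  intro b hb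
  obtain ⟨a, ha, rfl⟩ := List.mem_map.1 hb
  by_cases haX : a ∈ X
  · simp [haX]
  · simp [haX, h a ha haX]

/-- `L` is conditionally decomposable w.r.t. `E₁, E₂, E_k` iff
`f_{1+k}(L) ∥ f_{2+k}(L) ⊆ P̃⁻¹(L)`. -/
theorem stmt6 {A : Type} [DecidableEq A] (E₁ E₂ Ek T₁ T₂ : Finset A)
    (hk1 : E₁ ∩ E₂ ⊆ Ek) (hk2 : Ek ⊆ E₁ ∪ E₂)
    (hT1 : Disjoint T₁ (E₁ ∪ E₂)) (hT2 : Disjoint T₂ (E₁ ∪ E₂))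
    (hT12 : Disjoint T₁ T₂)
    (g₁ g₂ : A → A)
    (hg₁ : Set.BijOn g₁ ↑(E₁ \ Ek) ↑T₁) (hg₂ : Set.BijOn g₂ ↑(E₂ \ Ek) ↑T₂)
    (L : Set (List A)) (hL : L ⊆ star (E₁ ∪ E₂)) :
    condDecomp2 E₁ E₂ Ek L ↔
      par (E₁ ∪ Ek ∪ T₂) (E₂ ∪ Ek ∪ T₁)
          (ren (E₁ ∪ Ek) g₂ '' L) (ren (E₂ ∪ Ek) g₁ '' L) ⊆
        invProj (E₁ ∪ E₂ ∪ T₁ ∪ T₂) (E₁ ∪ E₂) L := by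
  have hgT₂ : ∀ u ∈ L, ∀ a ∈ u, a ∉ E₁ ∪ Ek → g₂ a ∈ T₂ := by
    intro u hu a ha haX
    have haE := hL hu a ha
    refine Finset.mem_coe.1 (hg₂.mapsTo (Finset.mem_coe.2 ?_))
    grind
  have hgT₁ : ∀ u ∈ L, ∀ a ∈ u, a ∉ E₂ ∪ Ek → g₁ a ∈ T₁ := by
    intro u hu a ha haX
    have haE := hL hu a ha
    refine Finset.mem_coe.1 (hg₁.mapsTo (Finset.mem_coe.2 ?_))
    grind
  have hX : E₁ ∪ Ek ⊆ E₁ ∪ E₂ := by grind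
  have hY : E₂ ∪ Ek ⊆ E₁ ∪ E₂ := by grind
  have hXY : E₁ ∪ Ek ∪ (E₂ ∪ Ek) = E₁ ∪ E₂ := by grind
  have hren₁ : ∀ u ∈ L, proj (E₁ ∪ Ek) (ren (E₁ ∪ Ek) g₂ u) = proj (E₁ ∪ Ek) u :=
    fun u hu => proj_ren fun a ha haX h =>
      Finset.disjoint_left.1 hT2 (hgT₂ u hu a ha haX) (hX h)
  have hren₂ : ∀ u ∈ L, proj (E₂ ∪ Ek) (ren (E₂ ∪ Ek) g₁ u) = proj (E₂ ∪ Ek) u :=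
    fun u hu => proj_ren fun a ha haY h =>
      Finset.disjoint_left.1 hT1 (hgT₁ u hu a ha haY) (hY h)
  constructor
  · rintro hdec w ⟨⟨hw, u, hu, huw⟩, -, v, hv, hvw⟩
    refine ⟨fun a ha => ?_, ?_⟩
    · have := hw a ha
      grind
    · rw [condDecomp2] at hdec
      rw [hdec]
      refine ⟨⟨hXY ▸ proj_mem_star _ _, u, hu, ?_⟩, hXY ▸ proj_mem_star _ _, v, hv, ?_⟩
      · rw [proj_proj_of_subset hX, ← hren₁ u hu, huw,
          proj_proj_of_subset Finset.subset_union_left]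
      · rw [proj_proj_of_subset hY, ← hren₂ v hv, hvw,
          proj_proj_of_subset Finset.subset_union_left]
  · intro hsub
    refine Set.Subset.antisymm (fun s hs => ?_) ?_
    · have hsE : s ∈ star (E₁ ∪ Ek ∪ (E₂ ∪ Ek)) := hXY ▸ hL hs
      exact ⟨⟨hsE, s, hs, rfl⟩, hsE, s, hs, rfl⟩
    · rintro s ⟨⟨hs, u, hu, hus⟩, -, v, hv, hvs⟩
      rw [hXY] at hs
      have hinter₁ : (E₁ ∪ E₂) ∩ (E₁ ∪ Ek ∪ T₂) = E₁ ∪ Ek := by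
        ext a
        rw [Finset.disjoint_left] at hT2
        grind
      have hinter₂ : (E₁ ∪ E₂ ∪ (E₁ ∪ Ek ∪ T₂)) ∩ (E₂ ∪ Ek ∪ T₁) = E₂ ∪ Ek := by
        ext a
        rw [Finset.disjoint_left] at hT1 hT2 hT12
        grind
      obtain ⟨t, ht, hts, htu⟩ := exists_interleaving hs (ren_mem_star (hgT₂ u hu))
        (by rw [hinter₁, hren₁ u hu, hus])
      obtain ⟨w, hw, hwt, hwv⟩ := exists_interleaving ht (ren_mem_star (hgT₁ v hv))
        (by rw [hinter₂, hren₂ v hv, hvs, ← hts, proj_proj_of_subset hY])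
      have hwu : proj (E₁ ∪ Ek ∪ T₂) w = ren (E₁ ∪ Ek) g₂ u := by
        rw [← htu, ← hwt, proj_proj_of_subset Finset.subset_union_right]
      have hws : proj (E₁ ∪ E₂) w = s := by
        rw [← hts, ← hwt, proj_proj_of_subset Finset.subset_union_left]
      have hw' : w ∈ star (E₁ ∪ Ek ∪ T₂ ∪ (E₂ ∪ Ek ∪ T₁)) := by
        intro a ha
        have := hw a ha
        grind
      rw [← hws]
      exact (hsub ⟨⟨hw', u, hu, hwu.symm⟩, hw', v, hv, hwv.symm⟩).2

end DES
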